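/- arXiv:2411.11136 — 2 statements merged into one kernel-verified Lean document; each statement's English description precedes it below -/
import Mathlib

section
/- Let G be a finite simple graph, let k > t ≥ 2 be integers, and let Q0 be a Revise-stable optimal k^−-star packing of G. Then there do not exist two distinct stars S and T of Q0, each with exactly t satellites, and a star S′ of Q0 with exactly one satellite, such that the center of S is adjacent in G to one of the two vertices of S′ and the center of T is adjacent in G to the other vertex of S′. -/
open SimpleGraph

variable {V : Type*}

/-- A star in a graph `G`: a center together with a finite set of satellites, each
adjacent to the center.  An `ℓ`-star is such a star with `sats.card = ℓ`. -/
structure GStar (G : SimpleGraph V) where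
  center : V
  sats : Finset V
  center_not_mem : center ∉ sats
  adj : ∀ v ∈ sats, G.Adj center v

/-- The vertex set of a star. -/
def GStar.verts {G : SimpleGraph V} (S : GStar G) : Set V :=
  insert S.center ↑S.sats

/-- The set of vertices covered by a collection of stars. -/
def coverSet {G : SimpleGraph V} (P : Set (GStar G)) : Set V :=
  ⋃ S ∈ P, S.verts

/-- A `k⁻`-star packing: pairwise vertex-disjoint `ℓ`-stars with `1 ≤ ℓ ≤ k`. -/
def IsKMinusPacking {G : SimpleGraph V} (k : ℕ) (Q : Set (GStar G)) : Prop :=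
  (∀ S ∈ Q, 1 ≤ S.sats.card ∧ S.sats.card ≤ k) ∧
  Q.Pairwise fun S T => Disjoint S.verts T.verts

/-- An optimal `k⁻`-star packing: one covering the maximum possible number of vertices. -/
def IsOptimalKMinusPacking {G : SimpleGraph V} (k : ℕ) (Q : Set (GStar G)) : Prop :=
  IsKMinusPacking k Q ∧
  ∀ Q' : Set (GStar G), IsKMinusPacking k Q' → (coverSet Q').ncard ≤ (coverSet Q).ncard

/-- A `k⁻/t`-star packing: pairwise vertex-disjoint `ℓ`-stars with `1 ≤ ℓ ≤ k`, `ℓ ≠ t`. -/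
def IsKtPacking {G : SimpleGraph V} (k t : ℕ) (Q : Set (GStar G)) : Prop :=
  (∀ S ∈ Q, 1 ≤ S.sats.card ∧ S.sats.card ≤ k ∧ S.sats.card ≠ t) ∧
  Q.Pairwise fun S T => Disjoint S.verts T.verts

/-- An optimal `k⁻/t`-star packing. -/
def IsOptimalKtPacking {G : SimpleGraph V} (k t : ℕ) (Q : Set (GStar G)) : Prop :=
  IsKtPacking k t Q ∧
  ∀ Q' : Set (GStar G), IsKtPacking k t Q' → (coverSet Q').ncard ≤ (coverSet Q).ncard

/-- A legal star for a `k⁻`-packing: `1 ≤ ℓ ≤ k` satellites. -/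
def OkStar {G : SimpleGraph V} (k : ℕ) (S : GStar G) : Prop :=
  1 ≤ S.sats.card ∧ S.sats.card ≤ k

/-- `W` can be partitioned into the vertex sets of two vertex-disjoint `ℓ`-stars of `G`
with `1 ≤ ℓ ≤ k`, neither of which has exactly `t` satellites. -/
def SplitsInto2NoT (G : SimpleGraph V) (k t : ℕ) (W : Set V) : Prop :=
  ∃ A B : GStar G, OkStar k A ∧ OkStar k B ∧ A.sats.card ≠ t ∧ B.sats.card ≠ t ∧
    Disjoint A.verts B.verts ∧ A.verts ∪ B.verts = W

/-- `W` can be partitioned into the vertex sets of three pairwise vertex-disjoint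
`ℓ`-stars of `G` with `1 ≤ ℓ ≤ k`, at most one of which has exactly `t` satellites. -/
def SplitsInto3AtMostOneT (G : SimpleGraph V) (k t : ℕ) (W : Set V) : Prop :=
  ∃ A B C : GStar G, OkStar k A ∧ OkStar k B ∧ OkStar k C ∧
    Disjoint A.verts B.verts ∧ Disjoint A.verts C.verts ∧ Disjoint B.verts C.verts ∧
    A.verts ∪ B.verts ∪ C.verts = W ∧
    ¬(A.sats.card = t ∧ B.sats.card = t) ∧ ¬(A.sats.card = t ∧ C.sats.card = t) ∧
    ¬(B.sats.card = t ∧ C.sats.card = t)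

/-- `W` can be partitioned into the vertex sets of three pairwise vertex-disjoint
`ℓ`-stars of `G` with `1 ≤ ℓ ≤ k`, none of which has exactly `t` satellites. -/
def SplitsInto3NoT (G : SimpleGraph V) (k t : ℕ) (W : Set V) : Prop :=
  ∃ A B C : GStar G, OkStar k A ∧ OkStar k B ∧ OkStar k C ∧
    A.sats.card ≠ t ∧ B.sats.card ≠ t ∧ C.sats.card ≠ t ∧
    Disjoint A.verts B.verts ∧ Disjoint A.verts C.verts ∧ Disjoint B.verts C.verts ∧
    A.verts ∪ B.verts ∪ C.verts = W

/-- A `k⁻`-star packing `Q0` is Revise-stable (conditions (R1), (R2), (R3)). -/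
def ReviseStable (G : SimpleGraph V) (k t : ℕ) (Q0 : Set (GStar G)) : Prop :=
  (3 ≤ t → ∀ S ∈ Q0, S.sats.card = t →
    ¬ ∃ A B : GStar G, A.sats.card = t - 2 ∧ B.sats.card = 1 ∧
        Disjoint A.verts B.verts ∧ A.verts ∪ B.verts = S.verts) ∧
  (∀ S ∈ Q0, S.sats.card = t → ∀ S' ∈ Q0, S' ≠ S →
    ¬ SplitsInto2NoT G k t (S.verts ∪ S'.verts) ∧
    ¬ SplitsInto3AtMostOneT G k t (S.verts ∪ S'.verts)) ∧
  (∀ S ∈ Q0, ∀ T ∈ Q0, S ≠ T → S.sats.card = t → T.sats.card = t →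
    ∀ S' ∈ Q0, S' ≠ S → S' ≠ T →
      (S'.sats.card = 1 ∨ S'.sats.card = t - 1 ∨ S'.sats.card = t + 1) →
      ¬ SplitsInto2NoT G k t (S.verts ∪ T.verts ∪ S'.verts) ∧
      ¬ SplitsInto3NoT G k t (S.verts ∪ T.verts ∪ S'.verts))

/-- The star obtained from `S` by adding a neighbor of the center as a further satellite. -/
def GStar.addSat [DecidableEq V] {G : SimpleGraph V} (S : GStar G) (a : V)
    (h : G.Adj S.center a) : GStar G where
  center := S.center
  sats := insert a S.sats
  center_not_mem := by
    simp only [Finset.mem_insert, not_or]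
    exact ⟨h.ne, S.center_not_mem⟩
  adj := by
    intro v hv
    rcases Finset.mem_insert.1 hv with rfl | hv
    · exact h
    · exact S.adj v hv

theorem GStar.verts_addSat [DecidableEq V] {G : SimpleGraph V} (S : GStar G) (a : V)
    (h : G.Adj S.center a) : (S.addSat a h).verts = insert a S.verts := by
  simp [GStar.verts, GStar.addSat, Set.insert_comm]

theorem GStar.card_sats_addSat [DecidableEq V] {G : SimpleGraph V} (S : GStar G) (a : V)
    (h : G.Adj S.center a) (ha : a ∉ S.verts) :
    (S.addSat a h).sats.card = S.sats.card + 1 :=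
  Finset.card_insert_of_notMem fun hs => ha (Or.inr hs)

/-- In a Revise-stable optimal `k⁻`-star packing, the centers of two distinct `t`-stars
cannot be adjacent to the two different vertices of one `1`-star of the packing. -/
theorem no_two_tstars_on_one_star [Fintype V] (G : SimpleGraph V) (k t : ℕ)
    (ht : 2 ≤ t) (htk : t < k)
    (Q0 : Set (GStar G)) (hQ0 : IsOptimalKMinusPacking k Q0)
    (hRS : ReviseStable G k t Q0) :
    ¬ ∃ S ∈ Q0, ∃ T ∈ Q0, ∃ S' ∈ Q0, S ≠ T ∧
        S.sats.card = t ∧ T.sats.card = t ∧ S'.sats.card = 1 ∧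
        ∃ a b : V, a ≠ b ∧ ({a, b} : Set V) = S'.verts ∧
          G.Adj S.center a ∧ G.Adj T.center b := by
  classical
  rintro ⟨S, hS, T, hT, S', hS', hST, hSt, hTt, hS'1, a, b, hab, hverts, hSa, hTb⟩
  have hne : ∀ R : GStar G, R.sats.card = t → S' ≠ R := by
    rintro R hR rfl
    omega
  have hdisj := hQ0.1.2
  have ha : a ∈ S'.verts := hverts ▸ Or.inl rfl
  have hb : b ∈ S'.verts := hverts ▸ Or.inr rfl
  have hS'S := Set.disjoint_left.1 (hdisj hS' hS (hne S hSt))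
  have hS'T := Set.disjoint_left.1 (hdisj hS' hT (hne T hTt))
  have hcS := S.card_sats_addSat a hSa (hS'S ha)
  have hcT := T.card_sats_addSat b hTb (hS'T hb)
  refine (hRS.2.2 S hS T hT hST hSt hTt S' hS' (hne S hSt) (hne T hTt) (Or.inl hS'1)).1
    ⟨S.addSat a hSa, T.addSat b hTb, ⟨by omega, by omega⟩, ⟨by omega, by omega⟩,
      by omega, by omega, ?_, ?_⟩
  · rw [GStar.verts_addSat, GStar.verts_addSat, Set.disjoint_insert_left,
      Set.disjoint_insert_right]
    exact ⟨fun h => h.elim hab (hS'T ha), hS'S hb, hdisj hS hT hST⟩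
  · rw [GStar.verts_addSat, GStar.verts_addSat, ← hverts]
    ext x
    simp only [Set.mem_union, Set.mem_insert_iff, Set.mem_singleton_iff]
    tauto
end

section
/- Let G be a finite simple graph, let k > t ≥ 2 be integers, and let Q0 be a Revise-stable optimal k^−-star packing of G. Then there do not exist two distinct stars S and T of Q0, each with exactly t satellites, and a star S′ of Q0 with exactly t+1 satellites, such that the center of S is adjacent in G to one satellite of S′ and the center of T is adjacent in G to a different satellite of S′. -/
open SimpleGraph

variable {V : Type*}

theorem GStar.mem_verts {G : SimpleGraph V} (S : GStar G) (v : V) :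
    v ∈ S.verts ↔ v = S.center ∨ v ∈ S.sats := by
  simp [GStar.verts]

/-- Enlarging a star by a new neighbor of its center. -/
def GStar.insertSat [DecidableEq V] {G : SimpleGraph V} (S : GStar G) (x : V)
    (h : G.Adj S.center x) : GStar G where
  center := S.center
  sats := insert x S.sats
  center_not_mem := by
    simpa [Finset.mem_insert, not_or] using And.intro h.ne S.center_not_mem
  adj := by
    intro v hv
    rcases Finset.mem_insert.mp hv with rfl | hv
    · exact h
    · exact S.adj v hv

/-- Removing one satellite from a star. -/
def GStar.eraseSat [DecidableEq V] {G : SimpleGraph V} (S : GStar G) (x : V) : GStar G where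
  center := S.center
  sats := S.sats.erase x
  center_not_mem := fun h => S.center_not_mem (Finset.mem_of_mem_erase h)
  adj := fun v hv => S.adj v (Finset.mem_of_mem_erase hv)

theorem GStar.verts_insertSat [DecidableEq V] {G : SimpleGraph V} (S : GStar G) (x : V)
    (h : G.Adj S.center x) : (S.insertSat x h).verts = insert x S.verts := by
  simp [GStar.verts, GStar.insertSat, Set.insert_comm]

theorem GStar.verts_eraseSat [DecidableEq V] {G : SimpleGraph V} (S : GStar G) {x : V}
    (h : x ∈ S.sats) : (S.eraseSat x).verts = S.verts \ {x} := by
  have hx : x ≠ S.center := fun e => S.center_not_mem (e ▸ h)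
  ext v
  simp only [GStar.verts, GStar.eraseSat, Set.mem_insert_iff, Finset.coe_erase, Set.mem_sdiff,
    Set.mem_singleton_iff, Finset.mem_coe]
  grind

theorem GStar.card_insertSat [DecidableEq V] {G : SimpleGraph V} (S : GStar G) {x : V}
    (h : G.Adj S.center x) (hx : x ∉ S.verts) :
    (S.insertSat x h).sats.card = S.sats.card + 1 :=
  Finset.card_insert_of_notMem fun hm => hx ((S.mem_verts x).mpr (Or.inr hm))

theorem GStar.card_eraseSat [DecidableEq V] {G : SimpleGraph V} (S : GStar G) {x : V}
    (h : x ∈ S.sats) : (S.eraseSat x).sats.card = S.sats.card - 1 :=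
  Finset.card_erase_of_mem h

/-- In a Revise-stable optimal `k⁻`-star packing, the centers of two distinct `t`-stars
cannot be adjacent to two different satellites of one `(t+1)`-star of the packing. -/
theorem no_two_tstars_on_tplusone_star [Fintype V] (G : SimpleGraph V) (k t : ℕ)
    (ht : 2 ≤ t) (htk : t < k)
    (Q0 : Set (GStar G)) (hQ0 : IsOptimalKMinusPacking k Q0)
    (hRS : ReviseStable G k t Q0) :
    ¬ ∃ S ∈ Q0, ∃ T ∈ Q0, ∃ S' ∈ Q0, S ≠ T ∧
        S.sats.card = t ∧ T.sats.card = t ∧ S'.sats.card = t + 1 ∧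
        ∃ x ∈ S'.sats, ∃ y ∈ S'.sats, x ≠ y ∧
          G.Adj S.center x ∧ G.Adj T.center y := by
  classical
  rintro ⟨S, hS, T, hT, S', hS', hST, cS, cT, cS', x, hx, y, hy, hxy, hSx, hTy⟩
  have hne : S' ≠ S := fun e => by subst e; omega
  have hne' : S' ≠ T := fun e => by subst e; omega
  have dST : Disjoint S.verts T.verts := hQ0.1.2 hS hT hST
  have dS : Disjoint S'.verts S.verts := hQ0.1.2 hS' hS hne
  have dT : Disjoint S'.verts T.verts := hQ0.1.2 hS' hT hne'
  have hxv : x ∈ S'.verts := (S'.mem_verts x).mpr (Or.inr hx)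
  have hyv : y ∈ S'.verts := (S'.mem_verts y).mpr (Or.inr hy)
  have hy' : y ∈ (S'.eraseSat x).sats := Finset.mem_erase.mpr ⟨hxy.symm, hy⟩
  have cA := S.card_insertSat hSx (Set.disjoint_left.mp dS hxv)
  have cB := T.card_insertSat hTy (Set.disjoint_left.mp dT hyv)
  have cC := (S'.eraseSat x).card_eraseSat hy'
  rw [S'.card_eraseSat hx] at cC
  refine (hRS.2.2 S hS T hT hST cS cT S' hS' hne hne' (Or.inr (Or.inr cS'))).2
    ⟨S.insertSat x hSx, T.insertSat y hTy, (S'.eraseSat x).eraseSat y,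
      ⟨by omega, by omega⟩, ⟨by omega, by omega⟩, ⟨by omega, by omega⟩,
      by omega, by omega, by omega, ?_, ?_, ?_, ?_⟩
  all_goals
    simp only [GStar.verts_insertSat, GStar.verts_eraseSat _ hy', GStar.verts_eraseSat _ hx]
    first
    | rw [Set.disjoint_left] at *
      intro v
      simp only [Set.mem_insert_iff, Set.mem_sdiff, Set.mem_singleton_iff]
      grind
    | ext v
      simp only [Set.mem_insert_iff, Set.mem_sdiff, Set.mem_singleton_iff, Set.mem_union]
      grind
end
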